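/- There exist a constant δ > 0 and a threshold K ∈ ℕ such that for every k ≥ K, if the weights a_1, …, a_k are i.i.d. Gaussian N(0, 2/k) (He normal initialization) and the biases b_1, …, b_k are i.i.d. Uniform[0,1] independent of the weights, then with probability at least δ the following holds: liminf_{t→∞} N(f_{a,b}^t)^{1/t} ≥ (1 + √5)/2, where f_{a,b}^t denotes the t-fold iterate of f_{a,b} and N(g) denotes the number of linear regions of g. In words, with constant probability the number of linear regions of the iterated RNN grows exponentially in the number t of feedback iterations, with growth rate at least the golden ratio φ = (1+√5)/2. -/

import Mathlib

open MeasureTheory ProbabilityTheory Filter Set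
open scoped NNReal ENNReal

/-- Clip a real number to the interval `[0,1]`. -/
noncomputable def clip (y : ℝ) : ℝ := min (max y 0) 1

/-- The RNN step map `f_{a,b}(x) = clip (∑ i, a i * ReLU (x - b i))`. -/
noncomputable def rnnStep {k : ℕ} (a b : Fin k → ℝ) (x : ℝ) : ℝ :=
  clip (∑ i, a i * max (x - b i) 0)

/-- `f` is Li-Yorke chaotic on `[0,1]`: there is an uncountable scrambled set. -/
def LiYorkeChaotic (f : ℝ → ℝ) : Prop :=
  ∃ S : Set ℝ, S ⊆ Set.Icc 0 1 ∧ ¬ S.Countable ∧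
    ∀ x ∈ S, ∀ y ∈ S, x ≠ y →
      Filter.liminf (fun n => |f^[n] x - f^[n] y|) Filter.atTop = 0 ∧
      0 < Filter.limsup (fun n => |f^[n] x - f^[n] y|) Filter.atTop

/-- The joint law of `k` i.i.d. `N(0, v)` weights and `k` i.i.d. `Uniform[0,1]`
biases, independent of each other. -/
noncomputable def rnnMeasure (k : ℕ) (v : ℝ≥0) :
    Measure ((Fin k → ℝ) × (Fin k → ℝ)) :=
  (Measure.pi fun _ => gaussianReal 0 v).prod
    (Measure.pi fun _ => volume.restrict (Set.Icc (0:ℝ) 1))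

/-- `g` is affine on the set `s`. -/
def IsAffineOn (g : ℝ → ℝ) (s : Set ℝ) : Prop :=
  ∃ c d : ℝ, ∀ x ∈ s, g x = c * x + d

/-- The number of linear regions of `g : [0,1] → ℝ`: the least `n` such that
`[0,1]` is covered by `n` intervals on each of which `g` is affine
(`⊤` if no such `n` exists). -/
noncomputable def numLinearRegions (g : ℝ → ℝ) : ℕ∞ :=
  sInf {n : ℕ∞ | ∃ m : ℕ, n = (m : ℕ∞) ∧ ∃ I : Fin m → Set ℝ,
    (∀ j, (I j).OrdConnected) ∧ (Set.Icc (0:ℝ) 1 ⊆ ⋃ j, I j) ∧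
    ∀ j, IsAffineOn g (I j)}

/-! ### Oscillations and linear regions -/

/-- A map sending `0, 1/2, 1` to `0, 1, 0` has iterates that oscillate `2 ^ t` times
between `0` and `1`. -/
lemma exists_monotone_alternating {f : ℝ → ℝ} (hf : Continuous f) (h0 : f 0 = 0)
    (h2 : f (1 / 2) = 1) (h1 : f 1 = 0) (t : ℕ) :
    ∃ y : ℕ → ℝ, (∀ j ≤ 2 ^ t, y j ∈ Icc (0 : ℝ) 1) ∧ (∀ j < 2 ^ t, y j ≤ y (j + 1)) ∧
      ∀ j ≤ 2 ^ t, f^[t] (y j) = if Even j then 0 else 1 := by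
  induction t with
  | zero =>
    refine ⟨fun j => if Even j then 0 else 1, fun j _ => ?_, fun j hj => ?_, fun j _ => rfl⟩
    · dsimp only; split_ifs <;> simp
    · obtain rfl : j = 0 := by simpa using hj
      simp
  | succ t ih =>
    obtain ⟨y, hmem, hle, hval⟩ := ih
    have hmid : ∀ j, ∃ w, j < 2 ^ t → w ∈ Icc (y j) (y (j + 1)) ∧ f^[t] w = 1 / 2 := by
      intro j
      by_cases hj : j < 2 ^ t
      · have hsub : (1 / 2 : ℝ) ∈ uIcc (f^[t] (y j)) (f^[t] (y (j + 1))) := by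
          rw [hval j hj.le, hval (j + 1) hj, mem_uIcc]
          by_cases he : Even j
          · simp [he, Nat.even_add_one]; norm_num
          · simp [he, Nat.even_add_one]; norm_num
        obtain ⟨w, hw, hw'⟩ := intermediate_value_uIcc (hf.iterate t).continuousOn hsub
        rw [uIcc_of_le (hle j hj)] at hw
        exact ⟨w, fun _ => ⟨hw, hw'⟩⟩
      · exact ⟨0, fun h => absurd h hj⟩
    choose w hw using hmid
    have hpow : 2 ^ (t + 1) = 2 * 2 ^ t := pow_succ' 2 t
    refine ⟨fun j => if Even j then y (j / 2) else w (j / 2), fun j hj => ?_, fun j hj => ?_,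
      fun j hj => ?_⟩
    · dsimp only
      split_ifs with he
      · exact hmem _ (by lia)
      · have hlt : j / 2 < 2 ^ t := by grind
        have hb := (hw _ hlt).1
        exact ⟨(hmem _ hlt.le).1.trans hb.1, hb.2.trans (hmem _ hlt).2⟩
    · dsimp only
      have hlt : j / 2 < 2 ^ t := by lia
      by_cases he : Even j
      · rw [if_pos he, if_neg (by simpa [Nat.even_add_one] using he),
          show (j + 1) / 2 = j / 2 by grind]
        exact (hw _ hlt).1.1
      · rw [if_neg he, if_pos (by simpa [Nat.even_add_one] using he),
          show (j + 1) / 2 = j / 2 + 1 by grind]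
        exact (hw _ hlt).1.2
    · dsimp only
      rw [Function.iterate_succ_apply']
      split_ifs with he
      · rw [hval _ (by lia)]
        split_ifs
        · exact h0
        · exact h1
      · rw [(hw _ (by grind)).2, h2]

/-- A function alternating between `0` and `1` along `2 * n + 1` increasing points has at
least `n` linear regions. -/
lemma le_numLinearRegions_of_alternating {g : ℝ → ℝ} {n : ℕ} {y : ℕ → ℝ}
    (hmem : ∀ j ≤ 2 * n, y j ∈ Icc (0 : ℝ) 1) (hle : ∀ j < 2 * n, y j ≤ y (j + 1))
    (hval : ∀ j ≤ 2 * n, g (y j) = if Even j then 0 else 1) :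
    (n : ℕ∞) ≤ numLinearRegions g := by
  have hmono : ∀ i j, i ≤ j → j ≤ 2 * n → y i ≤ y j := by
    intro i j hij hj
    induction j, hij using Nat.le_induction with
    | base => exact le_rfl
    | succ j _ ih => exact (ih (by lia)).trans (hle j (by lia))
  refine le_sInf ?_
  rintro _ ⟨m, rfl, I, hI, hcov, haff⟩
  have hpiece : ∀ i : Fin n, ∃ p, y (2 * i) ∈ I p := fun i =>
    mem_iUnion.1 (hcov (hmem _ (by lia)))
  choose p hp using hpiece
  have hlt : ∀ i j : Fin n, i < j → p i ≠ p j := by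
    intro i j hij heq
    have hij' : (i : ℕ) < j := hij
    have hj := hp j
    rw [← heq] at hj
    have hle1 : y (2 * i) ≤ y (2 * i + 1) := hle _ (by lia)
    have hle2 : y (2 * i + 1) ≤ y (2 * j) := hmono _ _ (by lia) (by lia)
    have hmid : y (2 * i + 1) ∈ I (p i) := (hI (p i)).out (hp i) hj ⟨hle1, hle2⟩
    obtain ⟨c, d, hcd⟩ := haff (p i)
    have e1 := hcd _ (hp i)
    have e2 := hcd _ hmid
    have e3 := hcd _ hj
    rw [hval _ (by lia)] at e1 e2 e3
    simp at e1 e2 e3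
    rcases le_total 0 c with hc | hc <;> nlinarith
  have hinj : Function.Injective p := fun i j h => by
    by_contra hne
    rcases lt_or_gt_of_ne hne with hij | hij
    · exact hlt i j hij h
    · exact hlt j i hij h.symm
  have := Fintype.card_le_of_injective p hinj
  simp only [Fintype.card_fin] at this
  exact_mod_cast this

lemma golden_pow_le_two_pow (t : ℕ) :
    ((1 + Real.sqrt 5) / 2) ^ (t + 4) ≤ (2 : ℝ) ^ (t + 3) := by
  have h5 : Real.sqrt 5 ^ 2 = 5 := Real.sq_sqrt (by norm_num)
  have hs0 := Real.sqrt_nonneg 5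
  have hs : Real.sqrt 5 ≤ 2.25 := by nlinarith
  induction t with
  | zero =>
    have h2 : ((1 + Real.sqrt 5) / 2) ^ 2 = (3 + Real.sqrt 5) / 2 := by nlinarith
    calc ((1 + Real.sqrt 5) / 2) ^ (0 + 4) = (((1 + Real.sqrt 5) / 2) ^ 2) ^ 2 := by ring
      _ ≤ 2 ^ (0 + 3) := by rw [h2]; nlinarith
  | succ t ih =>
    rw [show t + 1 + 4 = t + 4 + 1 by ring, show t + 1 + 3 = t + 3 + 1 by ring, pow_succ,
      pow_succ (2 : ℝ)]
    exact mul_le_mul ih (by linarith) (by positivity) (by positivity)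

/-- The linear regions of the iterates of a map sending `0, 1/2, 1` to `0, 1, 0` grow at least
like powers of the golden ratio. -/
lemma golden_le_liminf_numLinearRegions {f : ℝ → ℝ} (hf : Continuous f) (h0 : f 0 = 0)
    (h2 : f (1 / 2) = 1) (h1 : f 1 = 0) :
    ENNReal.ofReal ((1 + Real.sqrt 5) / 2) ≤
      Filter.liminf
        (fun t : ℕ => (ENat.toENNReal (numLinearRegions (f^[t]))) ^ ((1 : ℝ) / t))
        Filter.atTop := by
  refine le_liminf_of_le (by isBoundedDefault) ?_
  filter_upwards [eventually_ge_atTop 4] with t ht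
  obtain ⟨s, rfl⟩ := Nat.exists_eq_add_of_le' ht
  rw [one_div, ENNReal.le_rpow_inv_iff (by positivity), ENNReal.rpow_natCast,
    ← ENNReal.ofReal_pow (by positivity)]
  obtain ⟨y, hmem, hle, hval⟩ := exists_monotone_alternating hf h0 h2 h1 (s + 4)
  rw [show 2 ^ (s + 4) = 2 * 2 ^ (s + 3) by ring] at hmem hle hval
  have hN := ENat.toENNReal_le.2 (le_numLinearRegions_of_alternating hmem hle hval)
  refine le_trans ?_ hN
  rw [ENat.toENNReal_coe]
  refine (ENNReal.ofReal_le_ofReal (golden_pow_le_two_pow s)).trans ?_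
  rw [← ENNReal.ofReal_natCast]
  simp

/-! ### The step map -/

lemma continuous_rnnStep {k : ℕ} (a b : Fin k → ℝ) : Continuous (rnnStep a b) := by
  unfold rnnStep clip
  fun_prop

lemma clip_of_nonpos {y : ℝ} (h : y ≤ 0) : clip y = 0 := by simp [clip, h]

lemma clip_of_one_le {y : ℝ} (h : 1 ≤ y) : clip y = 1 := by
  simp [clip, h]

lemma rnnStep_zero {k : ℕ} (a : Fin k → ℝ) {b : Fin k → ℝ} (hb : ∀ i, 0 ≤ b i) :
    rnnStep a b 0 = 0 := by
  simp [rnnStep, clip, hb]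

/-! ### Linear forms in independent Gaussians -/

section Gaussian

variable {ι : Type*} [Fintype ι]

/-- A linear form in i.i.d. centred Gaussians is a centred Gaussian. -/
lemma map_pi_gaussianReal_linearForm (v : ℝ≥0) (c : ι → ℝ) :
    (Measure.pi fun _ : ι => gaussianReal 0 v).map (fun a => ∑ i, c i * a i) =
      gaussianReal 0 (Real.toNNReal (v * ∑ i, c i ^ 2)) := by
  have hlp : ∀ i, MemLp (fun x : ℝ => c i * x) 2 (gaussianReal 0 v) := fun i =>
    (memLp_id_gaussianReal 2).const_mul (c i)
  have hlaw : HasGaussianLaw (fun a : ι → ℝ => ∑ i, c i * a i)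
      (Measure.pi fun _ : ι => gaussianReal 0 v) := by
    refine iIndepFun.hasGaussianLaw_fun_sum (X := fun i (a : ι → ℝ) => c i * a i)
      (fun i => ⟨?_⟩)
      (iIndepFun_pi (X := fun i x => c i * x) fun i => by fun_prop)
    have hcomp : (fun a : ι → ℝ => c i * a i) = (fun x => c i * x) ∘ Function.eval i := rfl
    rw [hcomp, ← Measure.map_map (by fun_prop) (by fun_prop),
      (measurePreserving_eval (fun _ : ι => gaussianReal 0 v) i).map_eq,
      gaussianReal_map_const_mul]
    infer_instance
  rw [hlaw.map_eq_gaussianReal]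
  congr 1
  · rw [integral_finsetSum _ fun i _ => ?_]
    · refine Finset.sum_eq_zero fun i _ => ?_
      rw [integral_comp_eval (μ := fun _ : ι => gaussianReal 0 v) (f := fun x => c i * x)
        (by fun_prop), integral_const_mul, integral_id_gaussianReal, mul_zero]
    · exact ((hlp i).comp_measurePreserving
        (measurePreserving_eval (fun _ : ι => gaussianReal 0 v) i)).integrable (by norm_num)
  · congr 1
    have hfun : (fun a : ι → ℝ => ∑ i, c i * a i) = ∑ i, (fun a : ι → ℝ => c i * a i) := by
      ext a; simp
    rw [hfun, variance_sum_pi hlp, Finset.mul_sum]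
    refine Finset.sum_congr rfl fun i _ => ?_
    rw [variance_const_mul, variance_fun_id_gaussianReal, mul_comm]

/-- Upper tails of centred Gaussians increase with the variance. -/
lemma gaussianReal_Ici_mono {x : ℝ} (hx : 0 < x) {v w : ℝ≥0} (hvw : v ≤ w) :
    gaussianReal 0 v (Ici x) ≤ gaussianReal 0 w (Ici x) := by
  have hscale : ∀ u : ℝ≥0, gaussianReal 0 u = (gaussianReal 0 1).map (Real.sqrt u * ·) := by
    intro u
    rw [gaussianReal_map_const_mul]
    congr 1
    · simp
    · ext; simp
  rw [hscale v, hscale w, Measure.map_apply (by fun_prop) measurableSet_Ici,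
    Measure.map_apply (by fun_prop) measurableSet_Ici]
  refine measure_mono fun y hy => ?_
  simp only [mem_preimage, mem_Ici] at hy ⊢
  have hs : Real.sqrt v ≤ Real.sqrt w := Real.sqrt_le_sqrt (by exact_mod_cast hvw)
  have hy0 : 0 < y := pos_of_mul_pos_right (hx.trans_le hy) (Real.sqrt_nonneg _)
  exact hy.trans (mul_le_mul_of_nonneg_right hs hy0.le)

lemma gaussianReal_Ici_pos {v : ℝ≥0} (hv : v ≠ 0) (x : ℝ) : gaussianReal 0 v (Ici x) ≠ 0 :=
  fun h => by simpa using gaussianReal_absolutelyContinuous' 0 hv h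

lemma exists_gaussianReal_Ici_le (v : ℝ≥0) {ε : ℝ≥0∞} (hε : ε ≠ 0) :
    ∃ C : ℝ, 0 < C ∧ gaussianReal 0 v (Ici C) ≤ ε := by
  have htop : Tendsto (fun n : ℕ => gaussianReal 0 v (Ici (n : ℝ))) atTop (nhds 0) := by
    have hempty : ⋂ n : ℕ, Ici (n : ℝ) = ∅ := by
      ext x
      simpa using exists_nat_gt x
    rw [← measure_empty (μ := gaussianReal 0 v), ← hempty]
    refine tendsto_measure_iInter_atTop (fun n => measurableSet_Ici.nullMeasurableSet)
      (fun m n h => Ici_subset_Ici.2 (by exact_mod_cast h)) ⟨0, measure_ne_top _ _⟩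
  obtain ⟨n, hn, hn0⟩ :=
    ((htop.eventually (ge_mem_nhds hε.bot_lt)).and (eventually_gt_atTop 0)).exists
  exact ⟨n, by exact_mod_cast hn0, hn⟩

lemma le_measure_linearForm {v s : ℝ≥0} {c : ι → ℝ} {x : ℝ} (hx : 0 < x)
    (hs : (s : ℝ) ≤ v * ∑ i, c i ^ 2) :
    gaussianReal 0 s (Ici x) ≤
      (Measure.pi fun _ : ι => gaussianReal 0 v) {a | x ≤ ∑ i, c i * a i} := by
  refine (gaussianReal_Ici_mono hx (NNReal.le_toNNReal_of_coe_le hs)).trans_eq ?_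
  rw [← map_pi_gaussianReal_linearForm, Measure.map_apply (by fun_prop) measurableSet_Ici]
  rfl

lemma measure_linearForm_le {v s : ℝ≥0} {c : ι → ℝ} {x : ℝ} (hx : 0 < x)
    (hs : v * ∑ i, c i ^ 2 ≤ (s : ℝ)) :
    (Measure.pi fun _ : ι => gaussianReal 0 v) {a | x ≤ ∑ i, c i * a i} ≤
      gaussianReal 0 s (Ici x) := by
  refine le_trans (le_of_eq ?_) (gaussianReal_Ici_mono hx (Real.toNNReal_le_iff_le_coe.2 hs))
  rw [← map_pi_gaussianReal_linearForm, Measure.map_apply (by fun_prop) measurableSet_Ici]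
  rfl

/-- Linear forms with disjoint supports in independent variables are independent. -/
lemma indepFun_linearForm {μ : Measure ℝ} [IsProbabilityMeasure μ] (S : Finset ι) {u v w : ι → ℝ}
    (hu : ∀ i ∉ S, u i = 0) (hv : ∀ i ∉ S, v i = 0) (hw : ∀ i ∈ S, w i = 0) :
    IndepFun (fun a : ι → ℝ => (∑ i, u i * a i, ∑ i, v i * a i)) (fun a => ∑ i, w i * a i)
      (Measure.pi fun _ => μ) := by
  classical
  have hsum : ∀ (T : Finset ι) (c : ι → ℝ), (∀ i ∉ T, c i = 0) → ∀ a : ι → ℝ,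
      ∑ i, c i * a i = ∑ i : T, c i * a i := by
    intro T c hc a
    rw [Finset.sum_coe_sort T fun i => c i * a i]
    exact (Finset.sum_subset (Finset.subset_univ T) fun i _ hi => by simp [hc i hi]).symm
  have hind := (iIndepFun_pi (μ := fun _ : ι => μ) (X := fun _ x => x)
    fun _ => by fun_prop).indepFun_finset S Sᶜ disjoint_compl_right (by fun_prop)
  have hcomp := hind.comp
    (φ := fun z : S → ℝ => (∑ i : S, u i * z i, ∑ i : S, v i * z i))
    (ψ := fun z : (Sᶜ : Finset ι) → ℝ => ∑ i : (Sᶜ : Finset ι), w i * z i)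
    (by fun_prop) (by fun_prop)
  convert hcomp using 1
  · ext a : 1
    simp only [Function.comp_apply, hsum S u hu, hsum S v hv]
  · ext a : 1
    simp only [Function.comp_apply, hsum Sᶜ w fun i hi => hw i (by simpa using hi)]

end Gaussian

/-! ### Biases -/

/-- Chebyshev's inequality for the number of samples falling in a set of probability `1/4`. -/
lemma measure_count_lt_le {k : ℕ} (hk : 64 ≤ k) {μ : Measure ℝ} [IsProbabilityMeasure μ]
    {A : Set ℝ} (hA : MeasurableSet A) (hμ : μ.real A = 1 / 4) :
    (Measure.pi fun _ : Fin k => μ)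
      {b | ∑ i, A.indicator (fun _ => (1 : ℝ)) (b i) < k / 8} ≤ ENNReal.ofReal (1 / 4) := by
  have hk' : (64 : ℝ) ≤ k := by exact_mod_cast hk
  set g : ℝ → ℝ := A.indicator fun _ => 1 with hg
  have hgm : Measurable g := measurable_const.indicator hA
  have hgb : ∀ x, g x ∈ Icc (0 : ℝ) 1 := fun x => by
    by_cases hx : x ∈ A <;> simp [hg, hx]
  have hgp : MemLp g 2 μ :=
    memLp_of_bounded (Eventually.of_forall hgb) hgm.aestronglyMeasurable 2
  have hgi : ∫ x, g x ∂μ = 1 / 4 := by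
    rw [hg, integral_indicator_const _ hA, hμ]; simp
  have hgp' : ∀ i : Fin k, MemLp (fun b : Fin k → ℝ => g (b i)) 2 (Measure.pi fun _ => μ) :=
    fun i => hgp.comp_measurePreserving (measurePreserving_eval (fun _ : Fin k => μ) i)
  have hfun : (fun b : Fin k → ℝ => ∑ i, g (b i)) = ∑ i, (fun b : Fin k → ℝ => g (b i)) := by
    ext b; simp
  have hmean : ∫ b, ∑ i, g (b i) ∂(Measure.pi fun _ : Fin k => μ) = k / 4 := by
    rw [integral_finsetSum _ fun i _ => (hgp' i).integrable (by norm_num)]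
    simp_rw [integral_comp_eval (μ := fun _ : Fin k => μ) (f := g) hgm.aestronglyMeasurable, hgi]
    simp; ring
  have hvar : Var[fun b : Fin k → ℝ => ∑ i, g (b i); Measure.pi fun _ => μ] ≤ k / 4 := by
    rw [hfun, variance_sum_pi (μ := fun _ : Fin k => μ) (X := fun _ => g) fun _ => hgp]
    have h := variance_le_sq_of_bounded (Eventually.of_forall hgb) hgm.aemeasurable (μ := μ)
    simp only [Finset.sum_const, Finset.card_univ, Fintype.card_fin, nsmul_eq_mul]
    nlinarith
  have hlp : MemLp (fun b : Fin k → ℝ => ∑ i, g (b i)) 2 (Measure.pi fun _ => μ) :=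
    memLp_finsetSum _ fun i _ => hgp' i
  have hcheb := meas_ge_le_variance_div_sq hlp (c := k / 8) (by positivity)
  rw [hmean] at hcheb
  refine (measure_mono fun b hb => ?_).trans (hcheb.trans (ENNReal.ofReal_le_ofReal ?_))
  · simp only [mem_ofPred_eq] at hb ⊢
    rw [abs_sub_comm]
    exact le_trans (by linarith) (le_abs_self _)
  · rw [div_le_iff₀ (by positivity)]
    nlinarith

/-- The biases in `[0,1]` of which at least an eighth lie in each of two fixed intervals. -/
def balancedBiases (k : ℕ) : Set (Fin k → ℝ) :=
  {b | (∀ i, b i ∈ Icc (0 : ℝ) 1) ∧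
    (k : ℝ) / 8 ≤ ∑ i, (Icc (0 : ℝ) (1 / 4)).indicator (fun _ => (1 : ℝ)) (b i) ∧
    (k : ℝ) / 8 ≤ ∑ i, (Icc (1 / 2 : ℝ) (3 / 4)).indicator (fun _ => (1 : ℝ)) (b i)}

lemma measurableSet_balancedBiases (k : ℕ) : MeasurableSet (balancedBiases k) := by
  have hsum : ∀ A : Set ℝ, MeasurableSet A →
      Measurable fun b : Fin k → ℝ => ∑ i, A.indicator (fun _ => (1 : ℝ)) (b i) := fun A hA =>
    Finset.measurable_fun_sum _ fun i _ =>
      (measurable_const.indicator hA).comp (measurable_pi_apply i)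
  have hcube : MeasurableSet {b : Fin k → ℝ | ∀ i, b i ∈ Icc (0 : ℝ) 1} := by
    simp only [ofPred_forall]
    exact MeasurableSet.iInter fun i => measurableSet_Icc.preimage (measurable_pi_apply i)
  exact hcube.inter ((measurableSet_le measurable_const (hsum _ measurableSet_Icc)).inter
    (measurableSet_le measurable_const (hsum _ measurableSet_Icc)))

instance isProbabilityMeasure_uniform :
    IsProbabilityMeasure (volume.restrict (Icc (0 : ℝ) 1)) := ⟨by simp⟩

lemma half_le_measure_balancedBiases {k : ℕ} (hk : 64 ≤ k) :
    ENNReal.ofReal (1 / 2) ≤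
      (Measure.pi fun _ : Fin k => volume.restrict (Icc (0 : ℝ) 1)) (balancedBiases k) := by
  set ν : Measure (Fin k → ℝ) := Measure.pi fun _ : Fin k => volume.restrict (Icc (0 : ℝ) 1)
  have hcube : ν {b | ∀ i, b i ∈ Icc (0 : ℝ) 1}ᶜ = 0 := by
    have : ∀ᵐ b ∂ν, ∀ i, b i ∈ Icc (0 : ℝ) 1 := ae_all_iff.2 fun i =>
      Measure.tendsto_eval_ae_ae.eventually (ae_restrict_mem measurableSet_Icc)
    exact this
  have hleft := measure_count_lt_le hk (μ := volume.restrict (Icc (0 : ℝ) 1))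
    (A := Icc 0 (1 / 4)) measurableSet_Icc (by
      rw [measureReal_restrict_apply measurableSet_Icc, Icc_inter_Icc]; norm_num)
  have hright := measure_count_lt_le hk (μ := volume.restrict (Icc (0 : ℝ) 1))
    (A := Icc (1 / 2) (3 / 4)) measurableSet_Icc (by
      rw [measureReal_restrict_apply measurableSet_Icc, Icc_inter_Icc]; norm_num)
  have hcompl : ν (balancedBiases k)ᶜ ≤ ENNReal.ofReal (1 / 2) := by
    have hsub : (balancedBiases k)ᶜ ⊆ {b | ∀ i, b i ∈ Icc (0 : ℝ) 1}ᶜ ∪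
        ({b | ∑ i, (Icc (0 : ℝ) (1 / 4)).indicator (fun _ => (1 : ℝ)) (b i) < k / 8} ∪
          {b | ∑ i, (Icc (1 / 2 : ℝ) (3 / 4)).indicator (fun _ => (1 : ℝ)) (b i) < k / 8}) := by
      intro b hb
      by_contra hn
      simp only [mem_union, mem_compl_iff, mem_ofPred_eq, not_or, not_not, not_lt] at hn
      exact hb hn
    refine (measure_mono hsub).trans ((measure_union_le _ _).trans ?_)
    rw [hcube, zero_add]
    refine (measure_union_le _ _).trans ((add_le_add hleft hright).trans_eq ?_)
    rw [← ENNReal.ofReal_add (by norm_num) (by norm_num)]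
    norm_num
  have htot := prob_add_prob_compl (μ := ν) (measurableSet_balancedBiases k)
  by_contra! hlt
  have := ENNReal.add_lt_add_of_lt_of_le (by simp) hlt hcompl
  rw [htot, ← ENNReal.ofReal_add (by norm_num) (by norm_num)] at this
  norm_num at this

/-! ### Weights -/

lemma le_variance_of_count {k : ℕ} (hk : 0 < k) {A : Set ℝ} {b c : Fin k → ℝ}
    (hA : (k : ℝ) / 8 ≤ ∑ i, A.indicator (fun _ => (1 : ℝ)) (b i))
    (hc : ∀ i, b i ∈ A → 1 / 4 ≤ |c i|) :
    ((1 / 64 : ℝ≥0) : ℝ) ≤ (2 / k : ℝ≥0) * ∑ i, c i ^ 2 := by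
  have hk' : (0 : ℝ) < k := by exact_mod_cast hk
  have hterm : ∀ i, 1 / 16 * A.indicator (fun _ => (1 : ℝ)) (b i) ≤ c i ^ 2 := fun i => by
    by_cases hi : b i ∈ A
    · rw [indicator_of_mem hi, ← sq_abs]
      nlinarith [hc i hi]
    · rw [indicator_of_notMem hi]
      nlinarith [sq_nonneg (c i)]
  have hsum : (k : ℝ) / 128 ≤ ∑ i, c i ^ 2 := by
    refine le_trans ?_ (Finset.sum_le_sum fun i _ => hterm i)
    rw [← Finset.mul_sum]
    linarith
  push_cast
  rw [div_mul_eq_mul_div, le_div_iff₀ hk']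
  linarith

lemma variance_le_two {k : ℕ} {c : Fin k → ℝ} (hc : ∀ i, |c i| ≤ 1) :
    (2 / k : ℝ≥0) * ∑ i, c i ^ 2 ≤ ((2 : ℝ≥0) : ℝ) := by
  have hsum : ∑ i, c i ^ 2 ≤ (k : ℝ) := by
    simpa using Finset.sum_le_sum (s := Finset.univ) fun i _ =>
      (sq_le_one_iff_abs_le_one (c i)).2 (hc i)
  rcases Nat.eq_zero_or_pos k with rfl | hk
  · simp
  · push_cast
    rw [div_mul_eq_mul_div, div_le_iff₀ (by exact_mod_cast hk)]
    linarith

/-- For balanced biases, with probability bounded below the preactivation is at least `1` at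
`1/2` and nonpositive at `1`. -/
lemma le_measure_weights {k : ℕ} (hk : 0 < k) {b : Fin k → ℝ} (hb : b ∈ balancedBiases k) {C : ℝ}
    (hC0 : 0 < C)
    (hC : gaussianReal 0 2 (Ici C) ≤ gaussianReal 0 (1 / 64) (Ici 1) / 2) :
    gaussianReal 0 (1 / 64) (Ici 1) / 2 * gaussianReal 0 (1 / 64) (Ici C) ≤
      (Measure.pi fun _ : Fin k => gaussianReal 0 (2 / k))
        {a | 1 ≤ ∑ i, a i * max (1 / 2 - b i) 0 ∧ ∑ i, a i * max (1 - b i) 0 ≤ 0} := by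
  obtain ⟨hcube, hleft, hright⟩ := hb
  set ν : Measure (Fin k → ℝ) := Measure.pi fun _ : Fin k => gaussianReal 0 (2 / k)
  set S : Finset (Fin k) := {i | b i < 1 / 2} with hS
  set u : Fin k → ℝ := fun i => max (1 / 2 - b i) 0 with hu
  set v : Fin k → ℝ := fun i => if b i < 1 / 2 then 1 - b i else 0 with hv
  set w : Fin k → ℝ := fun i => if b i < 1 / 2 then 0 else -(1 - b i) with hw
  have hind : IndepFun (fun a => (∑ i, u i * a i, ∑ i, v i * a i)) (fun a => ∑ i, w i * a i) ν := by
    refine indepFun_linearForm S (fun i hi => ?_) (fun i hi => ?_) (fun i hi => ?_)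
    · simp only [hS, Finset.mem_filter_univ, not_lt] at hi
      simp only [hu, max_eq_right_iff]
      linarith
    · exact if_neg (by simpa [hS] using hi)
    · exact if_pos (by simpa [hS] using hi)
  have hU : gaussianReal 0 (1 / 64) (Ici 1) ≤ ν {a | 1 ≤ ∑ i, u i * a i} := by
    refine le_measure_linearForm one_pos (le_variance_of_count hk hleft fun i hi => ?_)
    exact le_trans (by linarith [hi.2]) ((le_max_left _ _).trans (le_abs_self _))
  have hV : ν {a | C ≤ ∑ i, v i * a i} ≤ gaussianReal 0 (1 / 64) (Ici 1) / 2 := by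
    refine (measure_linearForm_le hC0 (variance_le_two fun i => ?_)).trans hC
    have := hcube i
    simp only [hv]
    split_ifs
    · rw [abs_le]; constructor <;> linarith [this.1, this.2]
    · simp
  have hW : gaussianReal 0 (1 / 64) (Ici C) ≤ ν {a | C ≤ ∑ i, w i * a i} := by
    refine le_measure_linearForm hC0 (le_variance_of_count hk hright fun i hi => ?_)
    simp only [hw]
    rw [if_neg (not_lt.2 hi.1), abs_neg]
    exact le_trans (by linarith [hi.2]) (le_abs_self _)
  have hUV : gaussianReal 0 (1 / 64) (Ici 1) / 2 ≤
      ν ({a | 1 ≤ ∑ i, u i * a i} \ {a | C ≤ ∑ i, v i * a i}) := by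
    refine le_trans ?_ le_measure_sdiff
    rw [← ENNReal.sub_half (measure_ne_top (gaussianReal 0 (1 / 64)) (Ici 1))]
    exact tsub_le_tsub hU hV
  refine (mul_le_mul' hUV hW).trans ?_
  have hprod := hind.measure_inter_preimage_eq_mul ({p | 1 ≤ p.1} \ {p | C ≤ p.2}) (Ici C)
    ((measurableSet_le measurable_const measurable_fst).diff
      (measurableSet_le measurable_const measurable_snd)) measurableSet_Ici
  refine hprod.symm.le.trans (measure_mono fun a ha => ?_)
  obtain ⟨⟨hUa, hVa⟩, hWa⟩ := ha
  simp only [mem_ofPred_eq, mem_preimage, mem_Ici, not_le] at hUa hVa hWa ⊢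
  refine ⟨hUa.trans_eq (Finset.sum_congr rfl fun i _ => mul_comm _ _), ?_⟩
  have hsplit : ∑ i, a i * max (1 - b i) 0 = ∑ i, v i * a i - ∑ i, w i * a i := by
    rw [← Finset.sum_sub_distrib]
    refine Finset.sum_congr rfl fun i _ => ?_
    rw [max_eq_left (by linarith [(hcube i).2])]
    simp only [hv, hw]
    split_ifs <;> ring
  rw [hsplit]
  linarith
/-- Under He normal initialization, with probability at least some width-independent
constant `δ > 0`, the number of linear regions of the `t`-fold iterate of the RNN
step map grows exponentially in `t` with rate at least the golden ratio. -/
theorem linear_regions_grow_exponentially :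
    ∃ δ : ℝ, 0 < δ ∧ ∃ K : ℕ, ∀ k : ℕ, K ≤ k →
      ENNReal.ofReal δ ≤
        rnnMeasure k (2 / k)
          {p | ENNReal.ofReal ((1 + Real.sqrt 5) / 2) ≤
            Filter.liminf
              (fun t : ℕ =>
                (ENat.toENNReal (numLinearRegions ((rnnStep p.1 p.2)^[t]))) ^
                  ((1 : ℝ) / t))
              Filter.atTop} := by
  obtain ⟨C, hC0, hC⟩ := exists_gaussianReal_Ici_le 2
    (ε := gaussianReal 0 (1 / 64) (Ici 1) / 2) (by
      simpa using gaussianReal_Ici_pos (v := 1 / 64) (by simp) 1)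
  set q : ℝ≥0∞ := gaussianReal 0 (1 / 64) (Ici 1) / 2 * gaussianReal 0 (1 / 64) (Ici C) with hq
  have hq0 : q ≠ 0 := mul_ne_zero
    (by simpa using gaussianReal_Ici_pos (v := 1 / 64) (by simp) 1)
    (gaussianReal_Ici_pos (by simp) C)
  have hqtop : q ≠ ∞ := by
    rw [hq]
    finiteness
  refine ⟨q.toReal * (1 / 2), mul_pos (ENNReal.toReal_pos hq0 hqtop) (by norm_num), 64,
    fun k hk => ?_⟩
  rw [ENNReal.ofReal_mul ENNReal.toReal_nonneg, ENNReal.ofReal_toReal hqtop]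
  set T : Set ((Fin k → ℝ) × (Fin k → ℝ)) := {p | p.2 ∈ balancedBiases k ∧
    1 ≤ ∑ i, p.1 i * max (1 / 2 - p.2 i) 0 ∧ ∑ i, p.1 i * max (1 - p.2 i) 0 ≤ 0} with hT
  have hpre : ∀ x : ℝ, Measurable fun p : (Fin k → ℝ) × (Fin k → ℝ) =>
      ∑ i, p.1 i * max (x - p.2 i) 0 := fun x => by fun_prop
  have hTm : MeasurableSet T :=
    (measurable_snd (measurableSet_balancedBiases k)).inter
      ((measurableSet_le measurable_const (hpre _)).inter
        (measurableSet_le (hpre _) measurable_const))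
  have hsub : T ⊆ {p | ENNReal.ofReal ((1 + Real.sqrt 5) / 2) ≤ Filter.liminf
      (fun t : ℕ => (ENat.toENNReal (numLinearRegions ((rnnStep p.1 p.2)^[t]))) ^ ((1 : ℝ) / t))
      Filter.atTop} := fun p hp =>
    golden_le_liminf_numLinearRegions (continuous_rnnStep _ _)
      (rnnStep_zero _ fun i => (hp.1.1 i).1) (clip_of_one_le hp.2.1) (clip_of_nonpos hp.2.2)
  refine le_trans ?_ (measure_mono hsub)
  rw [rnnMeasure, Measure.prod_apply_symm hTm]
  calc q * ENNReal.ofReal (1 / 2)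
      ≤ q * (Measure.pi fun _ : Fin k => volume.restrict (Icc (0 : ℝ) 1)) (balancedBiases k) :=
        mul_le_mul_right (half_le_measure_balancedBiases hk) q
    _ = ∫⁻ _ in balancedBiases k, q
          ∂(Measure.pi fun _ : Fin k => volume.restrict (Icc (0 : ℝ) 1)) := by
        rw [setLIntegral_const]
    _ ≤ ∫⁻ b in balancedBiases k, (Measure.pi fun _ : Fin k => gaussianReal 0 (2 / k))
          ((fun a => (a, b)) ⁻¹' T)
          ∂(Measure.pi fun _ : Fin k => volume.restrict (Icc (0 : ℝ) 1)) := by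
        refine setLIntegral_mono' (measurableSet_balancedBiases k) fun b hb => ?_
        exact (le_measure_weights (by lia) hb hC0 hC).trans
          (measure_mono fun a ha => ⟨hb, ha⟩)
    _ ≤ _ := setLIntegral_le_lintegral _ _
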